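/- Let λ < 0, ω > 0, h > 0, α > 0 and κ, ν ∈ ℝ with κ² + ν ≥ 0. Then the cubic equation (9λ²/(4ω²)) r³ − (3λ/ω)(κ² + ν) r² + (α²/4 + (κ² + ν)²) r − h²/(4ω²) = 0 has exactly one nonnegative real solution r. -/

import Mathlib

/-- A cubic with nonnegative leading coefficients, positive linear coefficient and nonpositive
constant term has exactly one nonnegative real root. -/
theorem existsUnique_nonneg_root_of_cubic {a b c d : ℝ} (ha : 0 ≤ a) (hb : 0 ≤ b) (hc : 0 < c)
    (hd : 0 ≤ d) : ∃! r : ℝ, 0 ≤ r ∧ a * r ^ 3 + b * r ^ 2 + c * r - d = 0 := by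
  have hmono : StrictMonoOn (fun r : ℝ => a * r ^ 3 + b * r ^ 2 + c * r - d) (Set.Ici 0) := by
    intro x hx y _ hxy
    have hx : 0 ≤ x := hx
    have h₃ : a * x ^ 3 ≤ a * y ^ 3 := by gcongr
    have h₂ : b * x ^ 2 ≤ b * y ^ 2 := by gcongr
    have h₁ : c * x < c * y := by gcongr
    dsimp only
    linarith
  have hdc : 0 ≤ d / c := by positivity
  have hcont : ContinuousOn (fun r : ℝ => a * r ^ 3 + b * r ^ 2 + c * r - d)
      (Set.Icc 0 (d / c)) := by fun_prop
  obtain ⟨r, hr, hr₀⟩ : (0 : ℝ) ∈ (fun r : ℝ => a * r ^ 3 + b * r ^ 2 + c * r - d) ''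
      Set.Icc 0 (d / c) := by
    refine intermediate_value_Icc hdc hcont ⟨by simpa using hd, ?_⟩
    have h₁ : c * (d / c) = d := mul_div_cancel₀ d hc.ne'
    have h₃ : 0 ≤ a * (d / c) ^ 3 := by positivity
    have h₂ : 0 ≤ b * (d / c) ^ 2 := by positivity
    linarith
  exact ⟨r, ⟨hr.1, hr₀⟩, fun s hs => hmono.injOn hs.1 hr.1 (hs.2.trans hr₀.symm)⟩

/-- The cubic equation satisfied by `r = |R|²`, where `R` is the amplitude of the
spatially homogeneous (plane-wave) solution of the Lugiato–Lefever equation, has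
exactly one nonnegative real solution when the nonlinearity is softening (`λ < 0`). -/
theorem cubic_unique_nonneg_root (lam ω h α κ ν : ℝ)
    (hlam : lam < 0) (hω : 0 < ω) (hh : 0 < h) (hα : 0 < α)
    (hκν : 0 ≤ κ ^ 2 + ν) :
    ∃! r : ℝ, 0 ≤ r ∧
      (9 * lam ^ 2 / (4 * ω ^ 2)) * r ^ 3
        - (3 * lam / ω) * (κ ^ 2 + ν) * r ^ 2
        + (α ^ 2 / 4 + (κ ^ 2 + ν) ^ 2) * r
        - h ^ 2 / (4 * ω ^ 2) = 0 := by
  have hb : 0 ≤ -(3 * lam / ω * (κ ^ 2 + ν)) :=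
    neg_nonneg.2 (mul_nonpos_of_nonpos_of_nonneg
      (div_nonpos_of_nonpos_of_nonneg (by linarith) hω.le) hκν)
  simpa only [neg_mul, ← sub_eq_add_neg] using existsUnique_nonneg_root_of_cubic
    (a := 9 * lam ^ 2 / (4 * ω ^ 2)) (c := α ^ 2 / 4 + (κ ^ 2 + ν) ^ 2) (d := h ^ 2 / (4 * ω ^ 2))
    (by positivity) hb (by positivity) (by positivity)
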